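/- Let F be a field with characteristic different from 2, M ∈ F × F, r ∈ F with r ≠ 0, and let S be a subset of the circle C(M,r)_F of cardinality at least 3 such that for all P, Q ∈ S the squared distance D²(P,Q) equals a² for some a in the prime subfield of F. Then r² belongs to the prime subfield of F. -/

import Mathlib

/-- Squared distance between two points of `F × F`. -/
def sqDist {F : Type*} [Field F] (P Q : F × F) : F :=
  (P.1 - Q.1) ^ 2 + (P.2 - Q.2) ^ 2

/-- The circle of center `M` and radius `r` over a field `F`. -/
def circleSet {F : Type*} [Field F] (M : F × F) (r : F) : Set (F × F) :=
  {P | (P.1 - M.1) ^ 2 + (P.2 - M.2) ^ 2 = r ^ 2}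

/-- Distinct points of a circle of nonzero radius have nonzero squared distance. -/
theorem sqDist_ne_zero_of_mem_circleSet {F : Type*} [Field F] (h2 : (2 : F) ≠ 0)
    {M A B : F × F} {r : F} (hr : r ≠ 0) (hA : A ∈ circleSet M r) (hB : B ∈ circleSet M r)
    (hAB : A ≠ B) : sqDist A B ≠ 0 := by
  obtain ⟨m₁, m₂⟩ := M
  obtain ⟨a₁, a₂⟩ := A
  obtain ⟨b₁, b₂⟩ := B
  simp only [circleSet, sqDist, Set.mem_ofPred_eq] at *
  intro h
  have hperp : (a₁ - b₁) * (m₁ - b₁) + (a₂ - b₂) * (m₂ - b₂) = 0 := by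
    apply mul_left_cancel₀ h2
    linear_combination h - hA + hB
  have h₁ : (a₁ - b₁) ^ 2 * r ^ 2 = 0 := by
    linear_combination (-(a₁ - b₁) ^ 2) * hB + (m₂ - b₂) ^ 2 * h +
      ((a₁ - b₁) * (m₁ - b₁) - (a₂ - b₂) * (m₂ - b₂)) * hperp
  have h₂ : (a₂ - b₂) ^ 2 * r ^ 2 = 0 := by
    linear_combination (-(a₂ - b₂) ^ 2) * hB + (m₁ - b₁) ^ 2 * h +
      ((a₂ - b₂) * (m₂ - b₂) - (a₁ - b₁) * (m₁ - b₁)) * hperp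
  have e₁ : a₁ = b₁ := by simpa [hr, sub_eq_zero] using h₁
  have e₂ : a₂ = b₂ := by simpa [hr, sub_eq_zero] using h₂
  exact hAB (by rw [e₁, e₂])

/-- The circumradius formula: the squared radius of a circle through three points,
in terms of the squared distances between them. -/
theorem circumradius_sq_mul {F : Type*} [Field F] {M A B C : F × F} {r : F}
    (hA : A ∈ circleSet M r) (hB : B ∈ circleSet M r) (hC : C ∈ circleSet M r) :
    (4 * sqDist A C * sqDist B C - (sqDist A C + sqDist B C - sqDist A B) ^ 2) * r ^ 2 =
      sqDist A C * sqDist B C * sqDist A B := by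
  obtain ⟨m₁, m₂⟩ := M
  obtain ⟨a₁, a₂⟩ := A
  obtain ⟨b₁, b₂⟩ := B
  obtain ⟨c₁, c₂⟩ := C
  simp only [circleSet, sqDist, Set.mem_ofPred_eq] at *
  obtain ⟨u₁, rfl⟩ : ∃ u, a₁ = c₁ + u := ⟨a₁ - c₁, by ring⟩
  obtain ⟨u₂, rfl⟩ : ∃ u, a₂ = c₂ + u := ⟨a₂ - c₂, by ring⟩
  obtain ⟨v₁, rfl⟩ : ∃ v, b₁ = c₁ + v := ⟨b₁ - c₁, by ring⟩
  obtain ⟨v₂, rfl⟩ : ∃ v, b₂ = c₂ + v := ⟨b₂ - c₂, by ring⟩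
  obtain ⟨w₁, rfl⟩ : ∃ w, m₁ = c₁ + w := ⟨m₁ - c₁, by ring⟩
  obtain ⟨w₂, rfl⟩ : ∃ w, m₂ = c₂ + w := ⟨m₂ - c₂, by ring⟩
  have hu : 2 * (u₁ * w₁ + u₂ * w₂) = u₁ ^ 2 + u₂ ^ 2 := by linear_combination hC - hA
  have hv : 2 * (v₁ * w₁ + v₂ * w₂) = v₁ ^ 2 + v₂ ^ 2 := by linear_combination hC - hB
  have hw₁ : 2 * (u₁ * v₂ - u₂ * v₁) * w₁ =
      (u₁ ^ 2 + u₂ ^ 2) * v₂ - (v₁ ^ 2 + v₂ ^ 2) * u₂ := by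
    linear_combination v₂ * hu - u₂ * hv
  have hw₂ : 2 * (u₁ * v₂ - u₂ * v₁) * w₂ =
      (v₁ ^ 2 + v₂ ^ 2) * u₁ - (u₁ ^ 2 + u₂ ^ 2) * v₁ := by
    linear_combination u₁ * hv - v₁ * hu
  have hr : r ^ 2 = w₁ ^ 2 + w₂ ^ 2 := by linear_combination -hC
  rw [hr]
  linear_combination
    (2 * (u₁ * v₂ - u₂ * v₁) * w₁ + ((u₁ ^ 2 + u₂ ^ 2) * v₂ - (v₁ ^ 2 + v₂ ^ 2) * u₂)) * hw₁ +
    (2 * (u₁ * v₂ - u₂ * v₁) * w₂ + ((v₁ ^ 2 + v₂ ^ 2) * u₁ - (u₁ ^ 2 + u₂ ^ 2) * v₁)) * hw₂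

/-- If a circle carries a rational point set of cardinality at least three,
then the square of its radius lies in the prime subfield. -/
theorem radius_sq_mem_prime_subfield {F : Type*} [Field F] (hchar : ringChar F ≠ 2)
    (M : F × F) (r : F) (hr : r ≠ 0) (S : Set (F × F)) (hS : S ⊆ circleSet M r)
    (hcard : 3 ≤ S.encard)
    (hrat : ∀ P ∈ S, ∀ Q ∈ S, ∃ a ∈ (⊥ : Subfield F), sqDist P Q = a ^ 2) :
    r ^ 2 ∈ (⊥ : Subfield F) := by
  have h2 : (2 : F) ≠ 0 := Ring.two_ne_zero hchar
  obtain ⟨T, hTS, hT⟩ := Set.exists_subset_encard_eq hcard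
  obtain ⟨A, B, C, hAB, hAC, hBC, rfl⟩ := Set.encard_eq_three.mp hT
  have hA : A ∈ S := hTS (by simp)
  have hB : B ∈ S := hTS (by simp)
  have hC : C ∈ S := hTS (by simp)
  have hmem : ∀ P ∈ S, ∀ Q ∈ S, sqDist P Q ∈ (⊥ : Subfield F) := by
    intro P hP Q hQ
    obtain ⟨a, ha, h⟩ := hrat P hP Q hQ
    exact h ▸ pow_mem ha 2
  have key := circumradius_sq_mul (hS hA) (hS hB) (hS hC)
  have hne : sqDist A C * sqDist B C * sqDist A B ≠ 0 :=
    mul_ne_zero (mul_ne_zero (sqDist_ne_zero_of_mem_circleSet h2 hr (hS hA) (hS hC) hAC)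
      (sqDist_ne_zero_of_mem_circleSet h2 hr (hS hB) (hS hC) hBC))
      (sqDist_ne_zero_of_mem_circleSet h2 hr (hS hA) (hS hB) hAB)
  have hAC' := hmem A hA C hC
  have hBC' := hmem B hB C hC
  have hAB' := hmem A hA B hB
  rw [eq_div_of_mul_eq (left_ne_zero_of_mul (key ▸ hne)) ((mul_comm _ _).trans key)]
  exact div_mem (mul_mem (mul_mem hAC' hBC') hAB')
    (sub_mem (mul_mem (mul_mem (ofNat_mem _ 4) hAC') hBC')
      (pow_mem (sub_mem (add_mem hAC' hBC') hAB') 2))
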